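/- Let A be an associative K-algebra, let Q ∈ A be central and invertible, and fix i, j ∈ {1, …, N}. Suppose given elements y_k ∈ A for every k ∈ ℤ and pairwise commuting elements φ_1, φ_2, φ_3, … ∈ A, and define elements a_1, a_2, a_3, … ∈ A by the formal power series identity Σ_{r≥1} a_r z^{−r} = (q_i − q_i^{−1})^{−1} log(1 + (q_i − q_i^{−1})Σ_{r≥1} φ_r z^{−r}) in A[[z^{−1}]] (each a_r is the corresponding polynomial in φ_1, …, φ_r). Assume that [φ_1, y_k] = [A_{ij}]_i Q y_{k+1} for all k ∈ ℤ, and that [φ_r, y_k] = Q(q_i^{A_{ij}} φ_{r−1} y_{k+1} − q_i^{−A_{ij}} y_{k+1} φ_{r−1}) for all r ≥ 2 and all k ∈ ℤ. Then [a_r, y_k] = ([rA_{ij}]_i / r) Q^r y_{k+r} for all r ≥ 1 and all k ∈ ℤ. -/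

import Mathlib

noncomputable section

open Finset

/-- The base field `K = ℂ(v)`, with `v = q^{1/2}`. -/
abbrev KK : Type := RatFunc ℂ

/-- The variable `v = q^{1/2}`; thus `q^{a} = vv ^ (2*a)`. -/
def vv : KK := RatFunc.X

/-- `(ε_{k+1}, ε_{k+1})` for `0 ≤ k < N` (0-indexed). -/
def epsSq (n k : ℕ) : ℤ := if k < n then -1 else 1

/-- coefficient of `ε_{k+1}` (0-indexed `k`) in the simple root `α_i`, `0 ≤ i ≤ m+n`. -/
def co (m n i k : ℕ) : ℤ :=
  if i = 0 then (if k = 0 then -2 else 0)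
  else if i = m + n then (if k + 1 = m + n then 1 else 0)
  else (if k + 1 = i then 1 else 0) - (if k = i then 1 else 0)

/-- `(α_i, α_j)`. -/
def Bmat (m n i j : ℕ) : ℤ :=
  ∑ k ∈ Finset.range (m + n), epsSq n k * co m n i k * co m n j k

/-- `q_i = vv ^ qexp i`. -/
def qexp (m n i : ℕ) : ℤ := if Bmat m n i i = 0 then 2 else |Bmat m n i i|

/-- the quantum integer `[a]_i`. -/
def qint (m n i : ℕ) (a : ℤ) : KK :=
  (vv ^ (qexp m n i * a) - vv ^ (-(qexp m n i * a))) / (vv ^ qexp m n i - vv ^ (-qexp m n i))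

/-- the matrix `A_{ij}`. -/
def Amat (m n i j : ℕ) : ℤ := if i = m + n then 2 * Bmat m n i j else Bmat m n i j

/-- the `r`-th coefficient of `(q_i - q_i⁻¹)⁻¹ log(1 + (q_i - q_i⁻¹) Σ_{s≥1} φ_s z^{-s})`,
as an explicit polynomial in `φ_1, …, φ_r`:
`a_r = Σ_{k=1}^{r} (-1)^{k+1} c^{k-1} k⁻¹ Σ_{r_1+⋯+r_k = r, r_t ≥ 1} φ_{r_1} ⋯ φ_{r_k}`. -/
def logCoeff {A : Type*} [Ring A] [Algebra KK A] (c : KK) (φ : ℕ → A) (r : ℕ) : A :=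
  ∑ k ∈ Finset.Icc 1 r,
    ((-1 : KK) ^ (k + 1) * c ^ (k - 1) / (k : KK)) •
      ∑ f ∈ (Finset.Nat.antidiagonalTuple k r).filter (fun f => ∀ t, f t ≠ 0),
        (List.ofFn (fun t => φ (f t))).prod

theorem logCoeff_congr {A : Type*} [Ring A] [Algebra KK A] (c : KK) {φ φ' : ℕ → A}
    (h : ∀ s, s ≠ 0 → φ s = φ' s) (r : ℕ) : logCoeff c φ r = logCoeff c φ' r := by
  unfold logCoeff
  refine Finset.sum_congr rfl fun k _ => ?_
  congr 1
  refine Finset.sum_congr rfl fun f hf => ?_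
  congr 2
  funext t
  exact h _ ((Finset.mem_filter.1 hf).2 t)

theorem map_logCoeff {A E : Type*} [Ring A] [Algebra KK A] [Ring E] [Algebra KK E]
    (Φ : A →ₗ[KK] E) (c : KK) {φ : ℕ → A} {φ' : ℕ → E}
    (h : ∀ l : List ℕ, Φ (l.map φ).prod = (l.map φ').prod) (r : ℕ) :
    Φ (logCoeff c φ r) = logCoeff c φ' r := by
  simp only [logCoeff, map_sum, map_smul]
  refine Finset.sum_congr rfl fun k _ => ?_
  congr 1
  refine Finset.sum_congr rfl fun f _ => ?_
  have := h (List.ofFn f)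
  simpa only [List.map_ofFn, Function.comp_def] using this

theorem sum_antidiagonalTuple_prod_eq_coeff_pow {B : Type*} [CommRing B] {l : ℕ → B}
    (hl : l 0 = 0) (k r : ℕ) :
    ∑ f ∈ (Finset.Nat.antidiagonalTuple k r).filter (fun f => ∀ t, f t ≠ 0),
        (List.ofFn (fun t => l (f t))).prod = PowerSeries.coeff r (PowerSeries.mk l ^ k) := by
  rw [Finset.sum_filter_of_ne, ← Fin.prod_const, PowerSeries.coeff_prod]
  · refine (Finset.sum_equiv Finsupp.equivFunOnFinite (fun f => ?_) fun f _ => ?_).symm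
    · simp [Finset.Nat.mem_antidiagonalTuple]
    · simp [List.prod_ofFn]
  · intro f _ hf t ht
    refine hf ?_
    rw [List.prod_ofFn]
    exact Finset.prod_eq_zero (Finset.mem_univ t) (by rw [ht, hl])

/-- Up to the factor `r * c`, the coefficients of the logarithm are those of the logarithmic
derivative. -/
theorem smul_logCoeff_eq_coeff {B : Type*} [CommRing B] [Algebra KK B] {c : KK}
    {l : ℕ → B} (hl : l 0 = 0) {F U : PowerSeries B} (hF : F = c • PowerSeries.mk l)
    (hU : (1 + F) * U = 1) (r : ℕ) :
    (((r + 1 : ℕ) : KK) * c) • logCoeff c l (r + 1) =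
      PowerSeries.coeff r (PowerSeries.derivative B F * U) := by
  have hterm : ∀ k ∈ Finset.range (r + 1),
      (((r + 1 : ℕ) : KK) * c) • (((-1 : KK) ^ (k + 1 + 1) * c ^ (k + 1 - 1) / ((k + 1 : ℕ) : KK)) •
        PowerSeries.coeff (r + 1) (PowerSeries.mk l ^ (k + 1))) =
      PowerSeries.coeff r (PowerSeries.derivative B F * (-F) ^ k) := by
    intro k _
    have hk : ((k + 1 : ℕ) : KK) ≠ 0 := Nat.cast_ne_zero.2 k.succ_ne_zero
    have hd : PowerSeries.derivative B (F ^ (k + 1)) =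
        ((k + 1 : ℕ) : KK) • (F ^ k * PowerSeries.derivative B F) := by
      rw [Derivation.leibniz_pow, Nat.cast_smul_eq_nsmul]
      simp
    have hc := congrArg (PowerSeries.coeff r) hd
    rw [PowerSeries.coeff_derivative, PowerSeries.coeff_smul] at hc
    have hFk : F ^ (k + 1) = c ^ (k + 1) • PowerSeries.mk l ^ (k + 1) := by rw [hF, smul_pow]
    have hc' : (((r + 1 : ℕ) : KK) * c ^ (k + 1)) •
        PowerSeries.coeff (r + 1) (PowerSeries.mk l ^ (k + 1)) = ((k + 1 : ℕ) : KK) •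
          PowerSeries.coeff r (F ^ k * PowerSeries.derivative B F) := by
      rw [← hc, hFk, PowerSeries.coeff_smul, mul_smul,
        Nat.cast_smul_eq_nsmul, nsmul_eq_mul]
      push_cast
      ring
    have hs : (-F) ^ k = ((-1 : KK) ^ k) • F ^ k := by
      rw [← smul_pow, neg_one_smul]
    rw [hs, mul_smul_comm, PowerSeries.coeff_smul, mul_comm _ (F ^ k),
      ← inv_smul_smul₀ hk (PowerSeries.coeff r (F ^ k * _)), ← hc', smul_smul, smul_smul, smul_smul]
    congr 1
    rw [Nat.add_sub_cancel]
    field_simp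
    ring
  have hgeom : U - U * (-F) ^ (r + 1) = ∑ k ∈ Finset.range (r + 1), (-F) ^ k := by
    have := mul_neg_geom_sum (-F) (r + 1)
    linear_combination (-U) * this + (∑ k ∈ Finset.range (r + 1), (-F) ^ k) * hU
  have hX : PowerSeries.X ∣ F := by
    rw [PowerSeries.X_dvd_iff, hF]
    simp [hl]
  have hvanish : PowerSeries.coeff r (PowerSeries.derivative B F * (U * (-F) ^ (r + 1))) = 0 := by
    have h1 : (PowerSeries.X : PowerSeries B) ^ (r + 1) ∣
        PowerSeries.derivative B F * (U * (-F) ^ (r + 1)) :=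
      Dvd.dvd.mul_left (Dvd.dvd.mul_left (pow_dvd_pow_of_dvd (hX.neg_right) _) _) _
    exact PowerSeries.X_pow_dvd_iff.1 h1 r r.lt_succ_self
  have hU' : U = ∑ k ∈ Finset.range (r + 1), (-F) ^ k + U * (-F) ^ (r + 1) := by
    rw [← hgeom]; ring
  rw [hU', mul_add, map_add, hvanish, add_zero, Finset.mul_sum, map_sum,
    ← Finset.sum_congr rfl hterm, logCoeff, ← Finset.smul_sum]
  congr 1
  rw [← Finset.Ico_add_one_right_eq_Icc, Finset.sum_Ico_eq_sum_range]
  refine Finset.sum_congr (by simp) fun k _ => ?_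
  rw [sum_antidiagonalTuple_prod_eq_coeff_pow hl, add_comm 1 k]

theorem logCoeff_sub_logCoeff {B : Type*} [CommRing B] [Algebra KK B] {c p p' : KK} (hc : c ≠ 0)
    {l r : ℕ → B} {t : B} (hl : l 0 = 0) (hr : r 0 = 0)
    (h1 : l 1 - r 1 = ((p - p') / c) • t)
    (h2 : ∀ s, 1 ≤ s → l (s + 1) - r (s + 1) = p • (t * l s) - p' • (t * r s)) (s : ℕ) :
    logCoeff c l (s + 1) - logCoeff c r (s + 1) =
      ((p ^ (s + 1) - p' ^ (s + 1)) / c / ((s + 1 : ℕ) : KK)) • t ^ (s + 1) := by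
  have hs : ((s + 1 : ℕ) : KK) ≠ 0 := Nat.cast_ne_zero.2 s.succ_ne_zero
  obtain ⟨F, hF⟩ : ∃ F : PowerSeries B, F = c • PowerSeries.mk l := ⟨_, rfl⟩
  obtain ⟨G, hG⟩ : ∃ G : PowerSeries B, G = c • PowerSeries.mk r := ⟨_, rfl⟩
  have hinv : ∀ {H : PowerSeries B}, PowerSeries.constantCoeff H = 1 → ∃ U, H * U = 1 :=
    fun {H} hH => (PowerSeries.isUnit_iff_constantCoeff.2 (hH ▸ isUnit_one)).exists_right_inv
  obtain ⟨U, hU⟩ : ∃ U, (1 + F) * U = 1 := hinv (by simp [hF, hl])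
  obtain ⟨V, hV⟩ : ∃ V, (1 + G) * V = 1 := hinv (by simp [hG, hr])
  have hgeom : ∀ x : B, (1 - PowerSeries.C x * PowerSeries.X) * PowerSeries.mk (x ^ ·) = 1 := by
    intro x
    ext n
    rcases n with _ | n
    · simp
    · simp [sub_mul, mul_assoc, PowerSeries.coeff_succ_X_mul, PowerSeries.coeff_one, pow_succ']
  obtain ⟨P, hP⟩ : ∃ P : PowerSeries B, P = PowerSeries.mk ((p • t) ^ ·) := ⟨_, rfl⟩
  obtain ⟨P', hP'⟩ : ∃ P' : PowerSeries B, P' = PowerSeries.mk ((p' • t) ^ ·) := ⟨_, rfl⟩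
  have hPinv := hgeom (p • t)
  have hPinv' := hgeom (p' • t)
  rw [← hP] at hPinv
  rw [← hP'] at hPinv'
  have key : (1 + F) * (1 - PowerSeries.C (p • t) * PowerSeries.X) =
      (1 + G) * (1 - PowerSeries.C (p' • t) * PowerSeries.X) := by
    suffices F - G = PowerSeries.X * (PowerSeries.C (p • t) * (1 + F) -
        PowerSeries.C (p' • t) * (1 + G)) by linear_combination this
    ext n
    rcases n with _ | n
    · simp [hF, hG, hl, hr]
    · rw [PowerSeries.coeff_succ_X_mul, map_sub, map_sub, PowerSeries.coeff_C_mul,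
        PowerSeries.coeff_C_mul, hF, hG, map_add, map_add]
      simp only [PowerSeries.coeff_smul, PowerSeries.coeff_mk]
      rw [← smul_sub]
      rcases n with _ | n
      · rw [h1, smul_smul, mul_div_cancel₀ _ hc, hl, hr]
        simp [sub_smul]
      · rw [h2 _ n.succ_pos]
        simp [PowerSeries.coeff_one, smul_sub, smul_comm c]
  have hD := congrArg (PowerSeries.derivative B) key
  simp only [Derivation.leibniz, map_add, map_sub, PowerSeries.derivative_one,
    PowerSeries.derivative_C, PowerSeries.derivative_X, smul_eq_mul, zero_add, zero_sub, mul_one,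
    mul_zero, add_zero] at hD
  have hUP : U * P = V * P' := by
    refine left_inv_eq_right_inv
      (a := (1 + F) * (1 - PowerSeries.C (p • t) * PowerSeries.X)) ?_ ?_
    · linear_combination P * (1 - PowerSeries.C (p • t) * PowerSeries.X) * hU + hPinv
    · rw [key]
      linear_combination P' * (1 - PowerSeries.C (p' • t) * PowerSeries.X) * hV + hPinv'
  have hlog : PowerSeries.derivative B F * U - PowerSeries.derivative B G * V =
      PowerSeries.C (p • t) * P - PowerSeries.C (p' • t) * P' := by
    have e1 : PowerSeries.derivative B F * U - PowerSeries.C (p • t) * P =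
        (-((1 + F) * PowerSeries.C (p • t)) +
          (1 - PowerSeries.C (p • t) * PowerSeries.X) * PowerSeries.derivative B F) * (U * P) := by
      linear_combination PowerSeries.C (p • t) * P * hU - PowerSeries.derivative B F * U * hPinv
    have e2 : PowerSeries.derivative B G * V - PowerSeries.C (p' • t) * P' =
        (-((1 + G) * PowerSeries.C (p' • t)) +
          (1 - PowerSeries.C (p' • t) * PowerSeries.X) * PowerSeries.derivative B G) *
            (V * P') := by
      linear_combination PowerSeries.C (p' • t) * P' * hV - PowerSeries.derivative B G * V * hPinv'
    linear_combination e1 - e2 + U * P * hD + (-((1 + G) * PowerSeries.C (p' • t)) +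
          (1 - PowerSeries.C (p' • t) * PowerSeries.X) * PowerSeries.derivative B G) * hUP
  have hcoeff := congrArg (PowerSeries.coeff s) hlog
  rw [map_sub, ← smul_logCoeff_eq_coeff hl hF hU, ← smul_logCoeff_eq_coeff hr hG hV, map_sub,
    PowerSeries.coeff_C_mul, PowerSeries.coeff_C_mul, hP, hP', PowerSeries.coeff_mk,
    PowerSeries.coeff_mk, ← pow_succ', ← pow_succ', ← smul_sub, smul_pow, smul_pow,
    ← sub_smul] at hcoeff
  rw [← inv_smul_smul₀ (mul_ne_zero hs hc) (_ - _), hcoeff, smul_smul]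
  congr 1
  field_simp

theorem logCoeff_sub_logCoeff_smul {S M : Type*} [CommRing S] [Algebra KK S] [AddCommGroup M]
    [Module S M] (y : M) {c p p' : KK} (hc : c ≠ 0) {l r : ℕ → S} {t : S}
    (hl : l 0 = 0) (hr : r 0 = 0) (h1 : (l 1 - r 1) • y = (((p - p') / c) • t) • y)
    (h2 : ∀ s, 1 ≤ s → (l (s + 1) - r (s + 1)) • y = (p • (t * l s) - p' • (t * r s)) • y)
    (s : ℕ) :
    (logCoeff c l (s + 1) - logCoeff c r (s + 1)) • y =
      (((p ^ (s + 1) - p' ^ (s + 1)) / c / ((s + 1 : ℕ) : KK)) • t ^ (s + 1)) • y := by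
  let I : Ideal S := LinearMap.ker (LinearMap.toSpanSingleton S M y)
  let π : S →ₐ[KK] S ⧸ I := Ideal.Quotient.mkₐ KK I
  have hπ : ∀ a b : S, π a = π b ↔ a • y = b • y := by
    intro a b
    rw [Ideal.Quotient.mkₐ_eq_mk, Ideal.Quotient.eq, LinearMap.mem_ker,
      LinearMap.toSpanSingleton_apply, sub_smul, sub_eq_zero]
  have hlog : ∀ u : ℕ → S, π (logCoeff c u (s + 1)) = logCoeff c (fun i => π (u i)) (s + 1) :=
    fun u => map_logCoeff π.toLinearMap c
      (fun w => by simp [map_list_prod, List.map_map, Function.comp_def]) _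
  rw [← hπ, map_sub, hlog, hlog, map_smul, map_pow]
  refine logCoeff_sub_logCoeff hc (by simp [hl]) (by simp [hr]) ?_ (fun i hi => ?_) s
  · simpa using (hπ _ _).2 h1
  · simpa using (hπ _ _).2 (h2 i hi)

theorem commutator_logCoeff {A : Type*} [Ring A] [Algebra KK A] {c p p' : KK} (hc : c ≠ 0)
    {Q : A} (hQ : ∀ x : A, Q * x = x * Q) (y : ℤ → A) {φ : ℕ → A} (hφ0 : φ 0 = 0)
    (hφ : ∀ a b, φ a * φ b = φ b * φ a)
    (h1 : ∀ k, φ 1 * y k - y k * φ 1 = ((p - p') / c) • (Q * y (k + 1)))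
    (h2 : ∀ s, 1 ≤ s → ∀ k, φ (s + 1) * y k - y k * φ (s + 1) =
      Q * (p • (φ s * y (k + 1)) - p' • (y (k + 1) * φ s))) (s : ℕ) (k : ℤ) :
    logCoeff c φ (s + 1) * y k - y k * logCoeff c φ (s + 1) =
      ((p ^ (s + 1) - p' ^ (s + 1)) / c / ((s + 1 : ℕ) : KK)) •
        (Q ^ (s + 1) * y (k + (s + 1 : ℕ))) := by
  let L : A →ₗ[KK] Module.End KK (ℤ → A) :=
    { toFun := fun a => (LinearMap.mulLeft KK a).compLeft ℤ
      map_add' := fun a b => by ext; simp [add_mul]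
      map_smul' := fun a b => by ext; simp }
  let R : A →ₗ[KK] Module.End KK (ℤ → A) :=
    { toFun := fun a => (LinearMap.mulRight KK a).compLeft ℤ
      map_add' := fun a b => by ext; simp [mul_add]
      map_smul' := fun a b => by ext; simp }
  let T : Module.End KK (ℤ → A) :=
    { toFun := fun f k => Q * f (k + 1)
      map_add' := fun a b => by ext; simp [mul_add]
      map_smul' := fun a b => by ext; simp }
  have hL : ∀ a f k, L a f k = a * f k := fun _ _ _ => rfl
  have hR : ∀ a f k, R a f k = f k * a := fun _ _ _ => rfl
  have hT : ∀ f k, T f k = Q * f (k + 1) := fun _ _ => rfl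
  have hLL : ∀ a b, L a * L b = L (a * b) := fun a b => by
    refine LinearMap.ext fun f => funext fun k => ?_
    simp only [Module.End.mul_apply, hL, mul_assoc]
  have hRR : ∀ a b, R a * R b = R (b * a) := fun a b => by
    refine LinearMap.ext fun f => funext fun k => ?_
    simp only [Module.End.mul_apply, hR, mul_assoc]
  have hLR : ∀ a b, L a * R b = R b * L a := fun a b => by
    refine LinearMap.ext fun f => funext fun k => ?_
    simp only [Module.End.mul_apply, hR, hL, mul_assoc]
  have hLT : ∀ a, L a * T = T * L a := fun a => by
    refine LinearMap.ext fun f => funext fun k => ?_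
    simp only [Module.End.mul_apply, hT, hL, ← mul_assoc, hQ]
  have hRT : ∀ a, R a * T = T * R a := fun a => by
    refine LinearMap.ext fun f => funext fun k => ?_
    simp only [Module.End.mul_apply, hT, hR, mul_assoc]
  have hTpow : ∀ (s : ℕ) (f : ℤ → A) (k : ℤ), (T ^ s) f k = Q ^ s * f (k + s) := by
    intro s
    induction s with
    | zero => intro f k; simp
    | succ s ih =>
      intro f k
      rw [pow_succ, Module.End.mul_apply, ih, hT, ← mul_assoc, ← pow_succ]
      push_cast
      rw [add_assoc]
  let X : Set (Module.End KK (ℤ → A)) :=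
    Set.range (fun a => L (φ a)) ∪ Set.range (fun a => R (φ a)) ∪ {T}
  have hX : ∀ a ∈ X, ∀ b ∈ X, a * b = b * a := by
    rintro _ ((⟨a, rfl⟩ | ⟨a, rfl⟩) | rfl) _ ((⟨b, rfl⟩ | ⟨b, rfl⟩) | rfl) <;>
      simp only [hLL, hRR, hLR, hLT, hRT, hφ]
  let S := Algebra.adjoin KK X
  have hS := Algebra.isMulCommutative_adjoin KK hX
  let : CommRing S :=
    { (inferInstance : Ring S) with mul_comm := fun a b => hS.is_comm.comm a b }
  let l : ℕ → S := fun a => ⟨L (φ a), Algebra.subset_adjoin (Or.inl (Or.inl ⟨a, rfl⟩))⟩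
  let r : ℕ → S := fun a => ⟨R (φ a), Algebra.subset_adjoin (Or.inl (Or.inr ⟨a, rfl⟩))⟩
  let t : S := ⟨T, Algebra.subset_adjoin (Or.inr rfl)⟩
  have hsmul : ∀ (x : S) (f : ℤ → A), x • f = (x : Module.End KK (ℤ → A)) f := fun _ _ => rfl
  have hval : ∀ (u : ℕ → S) (s : ℕ), ((logCoeff c u s : S) : Module.End KK (ℤ → A)) =
      logCoeff c (fun i => (u i : Module.End KK (ℤ → A))) s :=
    fun u s => map_logCoeff S.val.toLinearMap c (φ := u)
      (φ' := fun i => (u i : Module.End KK (ℤ → A)))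
      (fun w => by simp [map_list_prod, List.map_map, Function.comp_def]) s
  have hLlog : ∀ s, logCoeff c (fun i => L (φ i)) s = L (logCoeff c φ s) := fun s =>
    (map_logCoeff L c (fun w => by
      induction w with
      | nil => exact LinearMap.ext fun f => funext fun k => one_mul (f k)
      | cons a w ih => rw [List.map_cons, List.prod_cons, ← hLL, ih, List.map_cons,
          List.prod_cons]) s).symm
  have hRlog : ∀ s, logCoeff c (fun i => R (φ i)) s = R (logCoeff c φ s) := fun s =>
    (map_logCoeff R c (fun w => by
      induction w with
      | nil => exact LinearMap.ext fun f => funext fun k => mul_one (f k)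
      | cons a w ih =>
        have hcomm : Commute (φ a) (w.map φ).prod := Commute.list_prod_right _ _ fun x hx => by
          obtain ⟨b, -, rfl⟩ := List.mem_map.1 hx
          exact hφ a b
        rw [List.map_cons, List.prod_cons, hcomm.eq, ← hRR, ih, List.map_cons,
          List.prod_cons]) s).symm
  have main := logCoeff_sub_logCoeff_smul (S := S) y hc (l := l) (r := r) (t := t) (p := p)
    (p' := p') (Subtype.ext (by simp [l, hφ0])) (Subtype.ext (by simp [r, hφ0])) ?_ ?_ s
  · have := congrFun main k
    rw [hsmul, hsmul] at this
    simpa [hval, l, r, t, hLlog, hRlog, hL, hR, hTpow] using this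
  · funext k
    rw [hsmul, hsmul]
    simpa [l, r, t, hL, hR, hT] using h1 k
  · intro s hs
    funext k
    rw [hsmul, hsmul]
    simpa [l, r, t, hL, hR, hT, mul_sub, mul_assoc] using h2 s hs k

theorem vv_zpow_ne_one {e : ℤ} (he : e ≠ 0) : vv ^ e ≠ 1 := by
  have hnat : ∀ k : ℕ, k ≠ 0 → vv ^ k ≠ 1 := by
    intro k hk h
    have hX : (Polynomial.X : Polynomial ℂ) ^ k = 1 := by
      apply RatFunc.algebraMap_injective ℂ
      simpa [vv] using h
    exact hk (by simpa using congrArg Polynomial.natDegree hX)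
  obtain h | h := Int.natAbs_eq e
  · rw [h, zpow_natCast]
    exact hnat _ (Int.natAbs_ne_zero.2 he)
  · rw [h, zpow_neg, zpow_natCast, ne_eq, inv_eq_one]
    exact hnat _ (Int.natAbs_ne_zero.2 he)

theorem vv_zpow_sub_zpow_neg_ne_zero {e : ℤ} (he : e ≠ 0) : vv ^ e - vv ^ (-e) ≠ 0 := by
  have hv : vv ≠ 0 := RatFunc.X_ne_zero
  intro h
  refine vv_zpow_ne_one (e := e + e) (by omega) ?_
  rw [zpow_add₀ hv]
  nth_rewrite 1 [sub_eq_zero.1 h]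
  rw [← zpow_add₀ hv, neg_add_cancel, zpow_zero]

theorem qexp_ne_zero (m n i : ℕ) : qexp m n i ≠ 0 := by
  unfold qexp
  split_ifs with h
  · norm_num
  · exact abs_ne_zero.2 h

/-- Lemma `LM5.1(2)`-style statement. -/
theorem log_coefficients_commutator
    {A : Type*} [Ring A] [Algebra KK A]
    (m n : ℕ) (hm : 1 ≤ m) (hn : 1 ≤ n)
    (i j : ℕ) (hi1 : 1 ≤ i) (hiN : i ≤ m + n) (hj1 : 1 ≤ j) (hjN : j ≤ m + n)
    (Q : Aˣ) (hQcentral : ∀ x : A, (Q : A) * x = x * (Q : A))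
    (y : ℤ → A) (φ : ℕ → A)
    (hφcomm : ∀ a b : ℕ, 1 ≤ a → 1 ≤ b → φ a * φ b = φ b * φ a)
    (a : ℕ → A)
    (hadef : ∀ r : ℕ, 1 ≤ r →
      a r = logCoeff (vv ^ qexp m n i - vv ^ (-qexp m n i)) φ r)
    (h1 : ∀ k : ℤ, φ 1 * y k - y k * φ 1 =
      qint m n i (Amat m n i j) • ((Q : A) * y (k + 1)))
    (h2 : ∀ r : ℕ, 2 ≤ r → ∀ k : ℤ, φ r * y k - y k * φ r =
      (Q : A) * ((vv ^ (qexp m n i * Amat m n i j)) • (φ (r - 1) * y (k + 1))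
        - (vv ^ (-(qexp m n i * Amat m n i j))) • (y (k + 1) * φ (r - 1)))) :
    ∀ r : ℕ, 1 ≤ r → ∀ k : ℤ,
      a r * y k - y k * a r =
        (qint m n i ((r : ℤ) * Amat m n i j) / (r : KK)) • ((Q : A) ^ r * y (k + r)) := by
  intro r hr k
  obtain ⟨s, rfl⟩ : ∃ s, r = s + 1 := ⟨r - 1, by omega⟩
  have hφ' : ∀ s, s ≠ 0 → φ s = Function.update φ 0 0 s := fun s hs => by simp [hs]
  rw [hadef _ hr, logCoeff_congr _ hφ',
    commutator_logCoeff (p := vv ^ (qexp m n i * Amat m n i j))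
      (p' := vv ^ (-(qexp m n i * Amat m n i j)))
      (vv_zpow_sub_zpow_neg_ne_zero (qexp_ne_zero m n i)) hQcentral y
      (by simp) ?_ ?_ ?_ s k]
  · congr 3
    rw [← zpow_natCast, ← zpow_natCast, ← zpow_mul, ← zpow_mul]
    congr 2 <;> ring
  · intro a b
    rcases Nat.eq_zero_or_pos a with rfl | ha
    · simp
    rcases Nat.eq_zero_or_pos b with rfl | hb
    · simp
    rw [← hφ' a ha.ne', ← hφ' b hb.ne']
    exact hφcomm a b ha hb
  · intro k
    rw [← hφ' 1 one_ne_zero]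
    exact h1 k
  · intro s hs k
    rw [← hφ' _ s.succ_ne_zero, ← hφ' s (by omega)]
    exact h2 (s + 1) (by omega) k
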